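/- arXiv:1309.1526 — 5 statements merged into one kernel-verified Lean document; each statement's English description precedes it below -/
import Mathlib

section
/- ∫_{-∞}^{∞} (1 - x·arctan(1/x)) dx = π/2. -/
open Real MeasureTheory

lemma arctan_le_self_of_nonneg {x : ℝ} (hx : 0 ≤ x) : arctan x ≤ x := by
  simpa [tan_arctan] using le_tan (arctan_nonneg.2 hx) (arctan_lt_pi_div_two x)

lemma div_one_add_sq_le_arctan {x : ℝ} (hx : 0 ≤ x) : x / (1 + x ^ 2) ≤ arctan x := by
  have h := sin_le (mul_nonneg zero_le_two (arctan_nonneg.2 hx))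
  have hs : √(1 + x ^ 2) * √(1 + x ^ 2) = 1 + x ^ 2 := mul_self_sqrt (by positivity)
  rw [sin_two_mul, sin_arctan, cos_arctan, mul_assoc, div_mul_div_comm, hs, mul_one] at h
  linarith

lemma hasDerivAt_half_add_arctan_sub (x : ℝ) :
    HasDerivAt (fun t ↦ (t + arctan t - t ^ 2 * (π / 2 - arctan t)) / 2)
      (1 - x * (π / 2 - arctan x)) x := by
  have h := (((hasDerivAt_id x).add (hasDerivAt_arctan' x)).sub
    ((hasDerivAt_pow 2 x).mul ((hasDerivAt_arctan' x).const_sub (π / 2)))).div_const 2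
  refine h.congr_deriv ?_
  have : (1 + x ^ 2) ≠ 0 := by positivity
  push_cast
  field_simp
  ring

lemma tendsto_self_sub_sq_mul_arctan_inv :
    Filter.Tendsto (fun x : ℝ ↦ x - x ^ 2 * arctan x⁻¹) Filter.atTop (nhds 0) := by
  refine squeeze_zero' ?_ ?_ tendsto_inv_atTop_zero
  · filter_upwards [Filter.eventually_gt_atTop 0] with x hx
    have h := mul_le_mul_of_nonneg_left (arctan_le_self_of_nonneg (inv_pos.2 hx).le) (sq_nonneg x)
    rw [show x ^ 2 * x⁻¹ = x by field_simp] at h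
    linarith
  · filter_upwards [Filter.eventually_gt_atTop 0] with x hx
    have h := mul_le_mul_of_nonneg_left (div_one_add_sq_le_arctan (inv_pos.2 hx).le) (sq_nonneg x)
    have h2 : x - x⁻¹ ≤ x ^ 2 * (x⁻¹ / (1 + x⁻¹ ^ 2)) := by
      rw [← sub_nonneg, show x ^ 2 * (x⁻¹ / (1 + x⁻¹ ^ 2)) - (x - x⁻¹) = 1 / (x * (x ^ 2 + 1)) by
        field_simp
        ring]
      positivity
    linarith

lemma integral_Ioi_one_sub_mul_arctan :
    ∫ x in Set.Ioi (0 : ℝ), (1 - x * arctan (1 / x)) = π / 4 := by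
  have h_eq : ∀ x ∈ Set.Ioi (0 : ℝ),
      1 - x * arctan (1 / x) = 1 - x * (π / 2 - arctan x) := fun x hx ↦ by
    rw [one_div, arctan_inv_of_pos hx]
  rw [setIntegral_congr_fun measurableSet_Ioi h_eq,
    integral_Ioi_of_hasDerivAt_of_nonneg' (l := π / 4)
      (fun x _ ↦ hasDerivAt_half_add_arctan_sub x)]
  · simp
  · intro x hx
    have hx0 : 0 < x := hx
    have h := mul_le_mul_of_nonneg_left (arctan_le_self_of_nonneg (inv_pos.2 hx0).le) hx0.le
    rw [mul_inv_cancel₀ hx0.ne'] at h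
    rw [← h_eq x hx, one_div]
    linarith
  · have h := (tendsto_self_sub_sq_mul_arctan_inv.add
      (tendsto_nhds_of_tendsto_nhdsWithin tendsto_arctan_atTop)).div_const 2
    rw [show (0 + π / 2) / 2 = π / 4 by ring] at h
    refine h.congr' ?_
    filter_upwards [Filter.eventually_gt_atTop 0] with x hx
    rw [arctan_inv_of_pos hx]
    ring

theorem integral_one_sub_mul_arctan :
    ∫ x : ℝ, (1 - x * Real.arctan (1 / x)) = π / 2 := by
  have h_even : ∀ x : ℝ, 1 - x * arctan (1 / x) = 1 - |x| * arctan (1 / |x|) := fun x ↦ by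
    rcases abs_choice x with h | h <;> simp [h, inv_neg, arctan_neg]
  rw [integral_congr_ae (.of_forall h_even)]
  rw [integral_comp_abs (f := fun x ↦ 1 - x * arctan (1 / x)), integral_Ioi_one_sub_mul_arctan]
  ring
end

section
/- For all real x > 0 and Δ > 0: arctan(Δ/x) - Δx/(x² + Δ²) = ∫_0^∞ ∫_0^∞ e^{-πλx²} · (t/(2√(πλ³))) · e^{-t²/(4λ)} · ((1/t)·sin(√π·Δ·t) - Δ·√π·cos(√π·Δ·t)) dt dλ. -/
open Real MeasureTheory

section Improper

open Set Filter Topology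

/-- The fundamental theorem of calculus on `(a, ∞)` for a nonnegative derivative, with one-sided
limits at both ends. -/
theorem integrableOn_and_integral_Ioi_of_hasDerivAt_of_nonneg {H h : ℝ → ℝ} {a L M : ℝ}
    (hderiv : ∀ l ∈ Ioi a, HasDerivAt H (h l) l) (hpos : ∀ l ∈ Ioi a, 0 ≤ h l)
    (hL : Tendsto H (𝓝[>] a) (𝓝 L)) (hM : Tendsto H atTop (𝓝 M)) :
    IntegrableOn h (Ioi a) ∧ ∫ l in Ioi a, h l = M - L := by
  have hcont : ContinuousWithinAt (Function.update H a L) (Ici a) a := by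
    rw [continuousWithinAt_update_same, Ici_sdiff_left]
    exact hL
  have hderiv' : ∀ l ∈ Ioi a, HasDerivAt (Function.update H a L) (h l) l := by
    intro l hl
    refine (hderiv l hl).congr_of_eventuallyEq ?_
    filter_upwards [Ioi_mem_nhds hl] with y hy
    exact Function.update_of_ne (ne_of_gt hy) _ _
  have hM' : Tendsto (Function.update H a L) atTop (𝓝 M) := by
    refine hM.congr' ?_
    filter_upwards [Ioi_mem_atTop a] with y hy
    exact (Function.update_of_ne (ne_of_gt hy) _ _).symm
  refine ⟨integrableOn_Ioi_deriv_of_nonneg hcont hderiv' hpos hM', ?_⟩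
  rw [integral_Ioi_of_hasDerivAt_of_nonneg hcont hderiv' hpos hM', Function.update_self]

end Improper

section Gaussian

open Filter Topology

/-- An unnormalised error function. -/
noncomputable def gaussPrimitive (u : ℝ) : ℝ := ∫ s in (0 : ℝ)..u, exp (-s ^ 2)

theorem hasDerivAt_gaussPrimitive (u : ℝ) : HasDerivAt gaussPrimitive (exp (-u ^ 2)) u := by
  have hc : Continuous fun s : ℝ => exp (-s ^ 2) := by fun_prop
  exact intervalIntegral.integral_hasDerivAt_right (hc.intervalIntegrable _ _)
    (hc.stronglyMeasurableAtFilter _ _) hc.continuousAt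

theorem tendsto_gaussPrimitive_atTop : Tendsto gaussPrimitive atTop (𝓝 (√π / 2)) := by
  have hi : Integrable fun s : ℝ => exp (-s ^ 2) := by
    simpa using integrable_exp_neg_mul_sq (b := 1) one_pos
  have h := intervalIntegral_tendsto_integral_Ioi 0 hi.integrableOn tendsto_id
  have hg := integral_gaussian_Ioi 1
  simp only [neg_mul, one_mul, div_one] at hg
  rwa [hg] at h

theorem gaussPrimitive_neg (u : ℝ) : gaussPrimitive (-u) = -gaussPrimitive u := by
  have h := intervalIntegral.integral_comp_neg (a := 0) (b := u) fun s : ℝ => exp (-s ^ 2)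
  simp only [even_two.neg_pow, neg_zero] at h
  rw [gaussPrimitive, gaussPrimitive, h, intervalIntegral.integral_symm]

theorem tendsto_gaussPrimitive_atBot : Tendsto gaussPrimitive atBot (𝓝 (-(√π / 2))) := by
  refine (tendsto_gaussPrimitive_atTop.comp tendsto_neg_atBot_atTop).neg.congr fun u => ?_
  simp [gaussPrimitive_neg]

end Gaussian

section Subordination

open Set Filter Topology

/-- A primitive in `l` of the one-sided `1/2`-stable density in `l`, tilted by `exp (-b ^ 2 * l)`. -/
noncomputable def subordinationPrimitive (b t l : ℝ) : ℝ :=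
  -(1 / √π) * (exp (-(b * t)) * gaussPrimitive (t / 2 * (√l)⁻¹ - b * √l) +
    exp (b * t) * gaussPrimitive (t / 2 * (√l)⁻¹ + b * √l))

theorem hasDerivAt_subordinationPrimitive (b t : ℝ) {l : ℝ} (hl : 0 < l) :
    HasDerivAt (subordinationPrimitive b t)
      (exp (-b ^ 2 * l) * (t / (2 * √(π * l ^ 3))) * exp (-t ^ 2 / (4 * l))) l := by
  have hs : 0 < √l := sqrt_pos.2 hl
  have hp : 0 < √π := sqrt_pos.2 pi_pos
  have hd := hasDerivAt_sqrt hl.ne'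
  have hi := (hd.inv hs.ne').const_mul (t / 2)
  have h1 := (hasDerivAt_gaussPrimitive _).comp l (hi.sub (hd.const_mul b))
  have h2 := (hasDerivAt_gaussPrimitive _).comp l (hi.add (hd.const_mul b))
  refine (((h1.const_mul (exp (-(b * t)))).add (h2.const_mul (exp (b * t)))).const_mul
    (-(1 / √π))).congr_deriv ?_
  have hsq : √l ^ 2 = l := sq_sqrt hl.le
  have hsqrt : √(π * l ^ 3) = √π * √l ^ 3 := by
    rw [sqrt_mul pi_pos.le, show l ^ 3 = (√l ^ 3) ^ 2 by rw [← pow_mul, mul_comm, pow_mul, hsq],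
      sqrt_sq (by positivity)]
  have key : ∀ c : ℝ, c ^ 2 = b ^ 2 →
      exp (c * t) * exp (-(t / 2 * (√l)⁻¹ + c * √l) ^ 2) =
        exp (-b ^ 2 * l) * exp (-t ^ 2 / (4 * l)) := by
    intro c hc
    rw [← exp_add, ← exp_add]
    congr 1
    have hquot : -t ^ 2 / (4 * l) = -t ^ 2 / (4 * √l ^ 2) := by rw [hsq]
    have hprod : -b ^ 2 * l = -c ^ 2 * √l ^ 2 := by rw [hsq, hc]
    rw [hquot, hprod]
    field_simp
    ring
  have k1 := key (-b) (by ring)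
  have k2 := key b rfl
  simp only [neg_mul, ← sub_eq_add_neg] at k1 k2
  simp only [Pi.inv_apply, neg_mul, Pi.sub_apply, Pi.add_apply]
  rw [← mul_assoc, ← mul_assoc, k1, k2, hsqrt]
  field_simp
  ring

theorem tendsto_subordinationPrimitive_zero (b : ℝ) {t : ℝ} (ht : 0 < t) :
    Tendsto (subordinationPrimitive b t) (𝓝[>] 0) (𝓝 (-(exp (-(b * t)) + exp (b * t)) / 2)) := by
  have hs : Tendsto (fun l : ℝ => √l) (𝓝[>] 0) (𝓝[>] 0) := by
    refine tendsto_nhdsWithin_iff.2 ⟨?_, ?_⟩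
    · have := (continuous_sqrt.tendsto 0).mono_left (nhdsWithin_le_nhds (s := Ioi 0))
      simpa using this
    · filter_upwards [self_mem_nhdsWithin] with l hl using sqrt_pos.2 hl
  have hi : Tendsto (fun l : ℝ => t / 2 * (√l)⁻¹) (𝓝[>] 0) atTop :=
    (tendsto_inv_nhdsGT_zero.comp hs).const_mul_atTop (half_pos ht)
  have hb : Tendsto (fun l : ℝ => b * √l) (𝓝[>] 0) (𝓝 (b * 0)) :=
    (hs.mono_right nhdsWithin_le_nhds).const_mul b
  have h1 := tendsto_gaussPrimitive_atTop.comp (hi.atTop_add hb.neg)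
  have h2 := tendsto_gaussPrimitive_atTop.comp (hi.atTop_add hb)
  have h := ((h1.const_mul (exp (-(b * t)))).add (h2.const_mul (exp (b * t)))).const_mul (-(1 / √π))
  have hp : 0 < √π := sqrt_pos.2 pi_pos
  convert h using 2
  · simp [subordinationPrimitive, sub_eq_add_neg]
  · field_simp

theorem tendsto_subordinationPrimitive_atTop {b : ℝ} (hb : 0 < b) (t : ℝ) :
    Tendsto (subordinationPrimitive b t) atTop (𝓝 (-(exp (b * t) - exp (-(b * t))) / 2)) := by
  have hi : Tendsto (fun l : ℝ => t / 2 * (√l)⁻¹) atTop (𝓝 (t / 2 * 0)) :=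
    (tendsto_inv_atTop_zero.comp tendsto_sqrt_atTop).const_mul _
  have hs : Tendsto (fun l : ℝ => b * √l) atTop atTop := tendsto_sqrt_atTop.const_mul_atTop hb
  have h1 := tendsto_gaussPrimitive_atBot.comp (hi.add_atBot (tendsto_neg_atTop_atBot.comp hs))
  have h2 := tendsto_gaussPrimitive_atTop.comp (hi.add_atTop hs)
  have h := ((h1.const_mul (exp (-(b * t)))).add (h2.const_mul (exp (b * t)))).const_mul (-(1 / √π))
  have hp : 0 < √π := sqrt_pos.2 pi_pos
  convert h using 2
  · simp [subordinationPrimitive, sub_eq_add_neg]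
  · field_simp
    ring

/-- The Laplace transform of the one-sided `1/2`-stable density. -/
theorem integrableOn_and_integral_subordination {b t : ℝ} (hb : 0 < b) (ht : 0 < t) :
    IntegrableOn (fun l => exp (-b ^ 2 * l) * (t / (2 * √(π * l ^ 3))) * exp (-t ^ 2 / (4 * l)))
        (Ioi 0) ∧
      ∫ l in Ioi (0 : ℝ), exp (-b ^ 2 * l) * (t / (2 * √(π * l ^ 3))) * exp (-t ^ 2 / (4 * l)) =
        exp (-b * t) := by
  have h := integrableOn_and_integral_Ioi_of_hasDerivAt_of_nonneg
    (fun l hl => hasDerivAt_subordinationPrimitive b t hl) (fun l _ => by positivity)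
    (tendsto_subordinationPrimitive_zero b ht) (tendsto_subordinationPrimitive_atTop hb t)
  refine ⟨h.1, h.2.trans ?_⟩
  rw [neg_mul]
  ring

/-- Subordination of the exponential against a bounded function. -/
theorem integral_integral_subordination {b C : ℝ} (hb : 0 < b) {g : ℝ → ℝ} (hg : Measurable g)
    (hC : ∀ t ∈ Ioi (0 : ℝ), |g t| ≤ C) :
    ∫ l in Ioi (0 : ℝ), ∫ t in Ioi (0 : ℝ),
        exp (-b ^ 2 * l) * (t / (2 * √(π * l ^ 3))) * exp (-t ^ 2 / (4 * l)) * g t =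
      ∫ t in Ioi (0 : ℝ), exp (-b * t) * g t := by
  rw [integral_integral_swap]
  · refine setIntegral_congr_fun measurableSet_Ioi fun t ht => ?_
    simp only [integral_mul_const, (integrableOn_and_integral_subordination hb ht).2]
  · have hm : Measurable (Function.uncurry fun l t : ℝ =>
        exp (-b ^ 2 * l) * (t / (2 * √(π * l ^ 3))) * exp (-t ^ 2 / (4 * l)) * g t) := by
      unfold Function.uncurry
      fun_prop
    rw [integrable_prod_iff' hm.aestronglyMeasurable]
    constructor
    · filter_upwards [ae_restrict_mem measurableSet_Ioi] with t ht
      exact (integrableOn_and_integral_subordination hb ht).1.mul_const (g t)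
    · have hint : IntegrableOn (fun t => exp (-b * t) * |g t|) (Ioi 0) := by
        refine ((exp_neg_integrableOn_Ioi 0 hb).mul_const C).mono'
          (by fun_prop) ?_
        filter_upwards [ae_restrict_mem measurableSet_Ioi] with t ht
        rw [norm_of_nonneg (by positivity)]
        exact mul_le_mul_of_nonneg_left (hC t ht) (exp_pos _).le
      refine hint.congr_fun (fun t ht => ?_) measurableSet_Ioi
      have ht' : (0 : ℝ) < t := ht
      simp only [Function.uncurry_apply_pair, norm_mul, norm_eq_abs]
      rw [integral_mul_const, ← (integrableOn_and_integral_subordination hb ht).2]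
      congr 1
      refine integral_congr_ae (ae_of_all _ fun l => ?_)
      simp only [← abs_mul]
      exact (abs_of_nonneg (by positivity)).symm

end Subordination

section Laplace

open Set Filter Topology

theorem integrableOn_exp_neg_mul_mul_cos {b : ℝ} (hb : 0 < b) (s : ℝ) :
    IntegrableOn (fun t => exp (-b * t) * cos (s * t)) (Ioi 0) := by
  refine (exp_neg_integrableOn_Ioi 0 hb).mono' (by fun_prop) (ae_of_all _ fun t => ?_)
  rw [norm_mul, norm_of_nonneg (exp_pos _).le]
  exact mul_le_of_le_one_right (exp_pos _).le (abs_cos_le_one _)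

theorem integral_exp_neg_mul_mul_cos {b : ℝ} (hb : 0 < b) (s : ℝ) :
    ∫ t in Ioi (0 : ℝ), exp (-b * t) * cos (s * t) = b / (b ^ 2 + s ^ 2) := by
  have hne : b ^ 2 + s ^ 2 ≠ 0 := by positivity
  have hderiv : ∀ t ∈ Ici (0 : ℝ), HasDerivAt
      (fun t => exp (-b * t) * ((s * sin (s * t) - b * cos (s * t)) / (b ^ 2 + s ^ 2)))
      (exp (-b * t) * cos (s * t)) t := by
    intro t _
    have hst : HasDerivAt (fun t => s * t) s t := by simpa using (hasDerivAt_id t).const_mul s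
    have hbt : HasDerivAt (fun t => -b * t) (-b) t := by simpa using (hasDerivAt_id t).const_mul (-b)
    refine (hbt.exp.mul (((hst.sin.const_mul s).sub (hst.cos.const_mul b)).div_const
      (b ^ 2 + s ^ 2))).congr_deriv ?_
    simp only [Pi.sub_apply]
    field_simp
    ring
  have hlim : Tendsto
      (fun t => exp (-b * t) * ((s * sin (s * t) - b * cos (s * t)) / (b ^ 2 + s ^ 2)))
      atTop (𝓝 0) := by
    have he : Tendsto (fun t => exp (-b * t)) atTop (𝓝 0) :=
      tendsto_exp_atBot.comp (tendsto_id.const_mul_atTop_of_neg (neg_neg_of_pos hb))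
    refine he.zero_mul_isBoundedUnder_le
      (isBoundedUnder_of ⟨(|s| + |b|) / (b ^ 2 + s ^ 2), fun t => ?_⟩)
    rw [Function.comp_apply, norm_eq_abs, abs_div, abs_of_nonneg (by positivity : 0 ≤ b ^ 2 + s ^ 2)]
    gcongr
    refine (abs_sub _ _).trans (add_le_add ?_ ?_) <;> rw [abs_mul]
    · exact mul_le_of_le_one_right (abs_nonneg _) (abs_sin_le_one _)
    · exact mul_le_of_le_one_right (abs_nonneg _) (abs_cos_le_one _)
  rw [integral_Ioi_of_hasDerivAt_of_tendsto' hderiv (integrableOn_exp_neg_mul_mul_cos hb s) hlim]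
  simp [neg_div]

theorem integral_cos_mul_left {a t : ℝ} (ht : t ≠ 0) :
    ∫ s in (0 : ℝ)..a, cos (s * t) = sin (a * t) / t := by
  rw [intervalIntegral.integral_comp_mul_right _ ht, integral_cos]
  simp [div_eq_inv_mul]

theorem integral_exp_neg_mul_mul_sin_div {b : ℝ} (hb : 0 < b) (a : ℝ) :
    ∫ t in Ioi (0 : ℝ), exp (-b * t) * (sin (a * t) / t) = arctan (a / b) := by
  have : IsFiniteMeasure (volume.restrict (uIoc 0 a)) :=
    isFiniteMeasure_restrict.2 measure_Ioc_lt_top.ne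
  have hswap := intervalIntegral_integral_swap (a := 0) (b := a) (μ := volume.restrict (Ioi (0 : ℝ)))
    (f := fun s t : ℝ => exp (-b * t) * cos (s * t)) (by
      have hdom : Integrable (fun p : ℝ × ℝ => (1 : ℝ) * exp (-b * p.2))
          ((volume.restrict (uIoc 0 a)).prod (volume.restrict (Ioi (0 : ℝ)))) :=
        (integrable_const (1 : ℝ)).mul_prod (exp_neg_integrableOn_Ioi 0 hb)
      refine hdom.mono' (by unfold Function.uncurry; fun_prop) (ae_of_all _ fun p => ?_)
      rw [Function.uncurry, norm_mul, norm_of_nonneg (exp_pos _).le, one_mul]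
      exact mul_le_of_le_one_right (exp_pos _).le (abs_cos_le_one _))
  simp only [integral_exp_neg_mul_mul_cos hb, integral_div_sq_add_sq,
    intervalIntegral.integral_const_mul] at hswap
  rw [zero_div, arctan_zero, sub_zero] at hswap
  rw [hswap]
  refine setIntegral_congr_fun measurableSet_Ioi fun t ht => ?_
  simp only [integral_cos_mul_left (ne_of_gt (show (0 : ℝ) < t from ht))]

theorem abs_sin_mul_div_le (a t : ℝ) : |sin (a * t) / t| ≤ |a| := by
  rw [abs_div]
  refine div_le_of_le_mul₀ (abs_nonneg _) (abs_nonneg _) ?_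
  rw [← abs_mul]
  exact abs_sin_le_abs

theorem integrableOn_exp_neg_mul_mul_sin_div {b : ℝ} (hb : 0 < b) (a : ℝ) :
    IntegrableOn (fun t => exp (-b * t) * (sin (a * t) / t)) (Ioi 0) := by
  refine ((exp_neg_integrableOn_Ioi 0 hb).mul_const |a|).mono'
    (by fun_prop) (ae_of_all _ fun t => ?_)
  rw [norm_mul, norm_of_nonneg (exp_pos _).le]
  exact mul_le_mul_of_nonneg_left (abs_sin_mul_div_le a t) (exp_pos _).le

end Laplace

theorem gaussian_subordination_rep (x Δ : ℝ) (hx : 0 < x) (hΔ : 0 < Δ) :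
    Real.arctan (Δ / x) - Δ * x / (x ^ 2 + Δ ^ 2)
      = ∫ l in Set.Ioi (0 : ℝ), ∫ t in Set.Ioi (0 : ℝ),
          Real.exp (-π * l * x ^ 2) * (t / (2 * Real.sqrt (π * l ^ 3))) *
            Real.exp (-t ^ 2 / (4 * l)) *
            ((1 / t) * Real.sin (Real.sqrt π * Δ * t) -
              Δ * Real.sqrt π * Real.cos (Real.sqrt π * Δ * t)) := by
  have hp : 0 < √π := sqrt_pos.2 pi_pos
  have hb : 0 < √π * x := by positivity
  set a := √π * Δ with ha
  have hexp : ∀ l : ℝ, -π * l * x ^ 2 = -(√π * x) ^ 2 * l := fun l => by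
    rw [mul_pow, sq_sqrt pi_pos.le]; ring
  have hg : ∀ t : ℝ, 1 / t * sin (a * t) - Δ * √π * cos (a * t) =
      sin (a * t) / t - a * cos (a * t) := fun t => by
    rw [ha]; ring
  have hC : ∀ t ∈ Set.Ioi (0 : ℝ), |sin (a * t) / t - a * cos (a * t)| ≤ |a| + |a| := by
    intro t _
    refine (abs_sub _ _).trans (add_le_add (abs_sin_mul_div_le a t) ?_)
    rw [abs_mul]
    exact mul_le_of_le_one_right (abs_nonneg _) (abs_cos_le_one _)
  simp only [hexp, hg]
  rw [integral_integral_subordination hb (by fun_prop) hC]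
  simp only [mul_sub, mul_left_comm _ a]
  rw [integral_sub (integrableOn_exp_neg_mul_mul_sin_div hb a)
      ((integrableOn_exp_neg_mul_mul_cos hb a).const_mul a), integral_const_mul,
    integral_exp_neg_mul_mul_sin_div hb, integral_exp_neg_mul_mul_cos hb, ha,
    mul_div_mul_left _ _ hp.ne']
  congr 1
  field_simp
end

section
/- For all real x > 0, y > 0, and Δ > 0: ∫_0^∞ (y/(2πΔλ^{3/2})) · e^{-πλx² - y²/(4πΔ²λ)} dλ = e^{-xy/Δ}. -/
open Real MeasureTheory

open Filter Topology Set in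
theorem integral_Ioi_of_hasDerivAt_of_nonneg_of_tendsto_nhdsGT {g g' : ℝ → ℝ} {a l m : ℝ}
    (hderiv : ∀ x ∈ Ioi a, HasDerivAt g (g' x) x) (g'pos : ∀ x ∈ Ioi a, 0 ≤ g' x)
    (ha : Tendsto g (𝓝[>] a) (𝓝 m)) (hg : Tendsto g atTop (𝓝 l)) :
    ∫ x in Ioi a, g' x = l - m := by
  have key := integral_Ioi_of_hasDerivAt_of_nonneg (g := Function.update g a m) (g' := g') (a := a)
    (l := l) ?_ ?_ g'pos ?_
  · simpa using key
  · rw [continuousWithinAt_update_same, Ici_sdiff_left]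
    exact ha
  · intro x hx
    refine (hderiv x hx).congr_of_eventuallyEq ?_
    filter_upwards [Ioi_mem_nhds hx] with z hz
    exact Function.update_of_ne (ne_of_gt hz) _ _
  · refine hg.congr' ?_
    filter_upwards [Ioi_mem_atTop a] with z hz
    exact (Function.update_of_ne (ne_of_gt hz) _ _).symm

/-- The primitive of the Gaussian `exp (-t ^ 2)` vanishing at `0`. -/
noncomputable def gaussianPrimitive (s : ℝ) : ℝ := ∫ t in (0 : ℝ)..s, Real.exp (-t ^ 2)

theorem hasDerivAt_gaussianPrimitive (s : ℝ) :
    HasDerivAt gaussianPrimitive (Real.exp (-s ^ 2)) s :=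
  (Continuous.integral_hasStrictDerivAt (f := fun t : ℝ => Real.exp (-t ^ 2))
    (by fun_prop) 0 s).hasDerivAt

theorem gaussianPrimitive_neg (s : ℝ) : gaussianPrimitive (-s) = -gaussianPrimitive s := by
  have h := intervalIntegral.integral_comp_neg (a := 0) (b := s) (fun t : ℝ => Real.exp (-t ^ 2))
  simp only [neg_sq, neg_zero] at h
  rw [gaussianPrimitive, gaussianPrimitive, h, intervalIntegral.integral_symm]

open Filter Topology in
theorem tendsto_gaussianPrimitive_atTop :
    Tendsto gaussianPrimitive atTop (𝓝 (√π / 2)) := by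
  have h1 := integral_gaussian_Ioi 1
  have h2 := (integrable_exp_neg_mul_sq one_pos).integrableOn (s := Set.Ioi 0)
  simp only [neg_mul, one_mul, div_one] at h1 h2
  rw [← h1]
  exact intervalIntegral_tendsto_integral_Ioi 0 h2 tendsto_id

open Filter Topology in
theorem tendsto_gaussianPrimitive_atBot :
    Tendsto gaussianPrimitive atBot (𝓝 (-(√π / 2))) := by
  refine (tendsto_gaussianPrimitive_atTop.comp tendsto_neg_atBot_atTop).neg.congr fun s => ?_
  simp [gaussianPrimitive_neg]

open Filter Topology in
theorem tendsto_mul_sqrt_add_div_sqrt_atTop {a : ℝ} (ha : 0 < a) (b : ℝ) :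
    Tendsto (fun l => a * √l + b / √l) atTop atTop :=
  (tendsto_sqrt_atTop.const_mul_atTop ha).atTop_add (tendsto_sqrt_atTop.const_div_atTop b)

open Filter Topology in
theorem tendsto_sqrt_nhdsGT_zero : Tendsto (fun l : ℝ => √l) (𝓝[>] 0) (𝓝[>] 0) := by
  refine tendsto_nhdsWithin_iff.2 ⟨?_, ?_⟩
  · exact (continuous_sqrt.tendsto' 0 0 sqrt_zero).mono_left nhdsWithin_le_nhds
  · filter_upwards [self_mem_nhdsWithin] with l hl
    exact sqrt_pos.2 hl

open Filter Topology in
theorem tendsto_mul_sqrt_add_div_sqrt_nhdsGT_zero (a : ℝ) {b : ℝ} (hb : 0 < b) :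
    Tendsto (fun l => a * √l + b / √l) (𝓝[>] 0) atTop := by
  have h := tendsto_sqrt_nhdsGT_zero
  simp only [div_eq_mul_inv]
  exact ((h.mono_right nhdsWithin_le_nhds).const_mul a).add_atTop
    ((tendsto_inv_nhdsGT_zero.comp h).const_mul_atTop hb)

theorem hasDerivAt_mul_sqrt_add_div_sqrt (a b : ℝ) {l : ℝ} (hl : 0 < l) :
    HasDerivAt (fun l => a * √l + b / √l) (a / (2 * √l) - b / (2 * (l * √l))) l := by
  have hs := sqrt_pos.2 hl
  have h := hasDerivAt_sqrt hl.ne'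
  refine ((h.const_mul a).add ((h.inv hs.ne').const_mul b)).congr_deriv ?_
  rw [sq_sqrt hl.le]
  field_simp
  ring

theorem integral_mul_exp_neg_sq_mul_add_sq_div {a b : ℝ} (ha : 0 < a) (hb : 0 < b) :
    ∫ l in Set.Ioi (0 : ℝ), b / (l * √l) * Real.exp (-(a ^ 2 * l) - b ^ 2 / l)
      = √π * Real.exp (-(2 * a * b)) := by
  have hneg (l : ℝ) : a * √l + -b / √l = -(-a * √l + b / √l) := by ring
  rw [integral_Ioi_of_hasDerivAt_of_nonneg_of_tendsto_nhdsGT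
    (g := fun l => Real.exp (-(2 * a * b)) * gaussianPrimitive (a * √l + -b / √l) -
      Real.exp (2 * a * b) * gaussianPrimitive (a * √l + b / √l))
    (m := Real.exp (-(2 * a * b)) * -(√π / 2) - Real.exp (2 * a * b) * (√π / 2))
    (l := Real.exp (-(2 * a * b)) * (√π / 2) - Real.exp (2 * a * b) * (√π / 2))]
  · ring
  · intro l hl
    have hs := sqrt_pos.2 hl
    have hsq := sq_sqrt (le_of_lt hl)
    have hl0 : l ≠ 0 := ne_of_gt hl
    have hd (c : ℝ) := (hasDerivAt_gaussianPrimitive _).comp l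
      (hasDerivAt_mul_sqrt_add_div_sqrt a c hl)
    refine (((hd (-b)).const_mul _).sub ((hd b).const_mul _)).congr_deriv ?_
    have hexp (c : ℝ) : -(a * √l + c / √l) ^ 2 = -(2 * a * c) + (-(a ^ 2 * l) - c ^ 2 / l) := by
      rw [add_sq, mul_pow, div_pow, hsq]
      field_simp
      ring
    have hcancel (c E D : ℝ) : Real.exp c * (Real.exp (-c + E) * D) = Real.exp E * D := by
      rw [← mul_assoc, ← Real.exp_add, add_neg_cancel_left]
    have hminus : -(2 * a * -b) = -(-(2 * a * b)) := by ring
    rw [hexp, hexp, hminus, hcancel, hcancel, neg_sq]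
    field_simp
    ring
  · intro l hl
    have : 0 < l := hl
    positivity
  · refine ((Filter.Tendsto.comp tendsto_gaussianPrimitive_atBot ?_).const_mul _).sub
      ((tendsto_gaussianPrimitive_atTop.comp
        (tendsto_mul_sqrt_add_div_sqrt_nhdsGT_zero a hb)).const_mul _)
    simp only [hneg]
    exact Filter.tendsto_neg_atTop_atBot.comp (tendsto_mul_sqrt_add_div_sqrt_nhdsGT_zero _ hb)
  · have h (c : ℝ) := tendsto_gaussianPrimitive_atTop.comp
      (tendsto_mul_sqrt_add_div_sqrt_atTop ha c)
    exact ((h (-b)).const_mul _).sub ((h b).const_mul _)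

theorem integral_subordination_kernel (x y Δ : ℝ) (hx : 0 < x) (hy : 0 < y) (hΔ : 0 < Δ) :
    ∫ l in Set.Ioi (0 : ℝ),
        (y / (2 * π * Δ * l ^ ((3 : ℝ) / 2))) *
          Real.exp (-π * l * x ^ 2 - y ^ 2 / (4 * π * Δ ^ 2 * l))
      = Real.exp (-(x * y) / Δ) := by
  have hπ : 0 < √π := sqrt_pos.2 pi_pos
  have hsq : √π ^ 2 = π := sq_sqrt pi_pos.le
  have key := integral_mul_exp_neg_sq_mul_add_sq_div (a := √π * x) (b := y / (2 * Δ * √π))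
    (by positivity) (by positivity)
  have hexp : -(2 * (√π * x) * (y / (2 * Δ * √π))) = -(x * y) / Δ := by field_simp
  rw [hexp] at key
  rw [← mul_right_inj' hπ.ne', ← key, ← integral_const_mul]
  refine setIntegral_congr_fun measurableSet_Ioi fun l hl => ?_
  have hl : 0 < l := hl
  have hpow : l ^ ((3 : ℝ) / 2) = l * √l := by
    rw [sqrt_eq_rpow, ← rpow_one_add' hl.le (by norm_num)]
    norm_num
  have hs := sqrt_pos.2 hl
  simp only [hpow, mul_pow, div_pow, hsq]
  rw [← mul_assoc]
  congr 1
  · field_simp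
    rw [hsq]
  · congr 1
    field_simp
    ring
end

section
/- For every real a > 0: ∫_0^∞ e^{-y²/(4a²)} · (sin y - y·cos y) dy ≥ 0. -/
open Real MeasureTheory

open Filter Topology Set

lemma integrableOn_exp_neg_mul_sq_mul_sin {b : ℝ} (hb : 0 < b) (t : ℝ) :
    IntegrableOn (fun y : ℝ => exp (-b * y ^ 2) * sin (t * y)) (Ioi 0) := by
  refine Integrable.mono' (integrable_exp_neg_mul_sq hb).integrableOn
    (by fun_prop) (ae_of_all _ fun y => ?_)
  rw [norm_mul, norm_eq_abs, norm_eq_abs, abs_exp]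
  exact mul_le_of_le_one_right (exp_pos _).le (abs_sin_le_one _)

lemma integrableOn_mul_exp_neg_mul_sq_mul_cos {b : ℝ} (hb : 0 < b) (t : ℝ) :
    IntegrableOn (fun y : ℝ => y * exp (-b * y ^ 2) * cos (t * y)) (Ioi 0) := by
  refine Integrable.mono' (integrable_mul_exp_neg_mul_sq hb).norm.integrableOn
    (by fun_prop) (ae_of_all _ fun y => ?_)
  rw [norm_mul, norm_eq_abs (cos _)]
  exact mul_le_of_le_one_right (norm_nonneg _) (abs_cos_le_one _)

/-- The derivative of the half-line sine transform of a Gaussian. -/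
lemma hasDerivAt_integral_exp_neg_mul_sq_mul_sin {b : ℝ} (hb : 0 < b) (t : ℝ) :
    HasDerivAt (fun t : ℝ => ∫ y in Ioi (0 : ℝ), exp (-b * y ^ 2) * sin (t * y))
      (∫ y in Ioi (0 : ℝ), y * exp (-b * y ^ 2) * cos (t * y)) t := by
  refine (hasDerivAt_integral_of_dominated_loc_of_deriv_le
    (F := fun t y : ℝ => exp (-b * y ^ 2) * sin (t * y))
    (F' := fun t y : ℝ => y * exp (-b * y ^ 2) * cos (t * y))
    (bound := fun y => ‖y * exp (-b * y ^ 2)‖) (s := univ) univ_mem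
    (Eventually.of_forall fun x => (integrableOn_exp_neg_mul_sq_mul_sin hb x).1)
    (integrableOn_exp_neg_mul_sq_mul_sin hb t)
    (integrableOn_mul_exp_neg_mul_sq_mul_cos hb t).1
    (ae_of_all _ fun y x _ => ?_)
    (integrable_mul_exp_neg_mul_sq hb).norm.integrableOn
    (ae_of_all _ fun y x _ => ?_)).2
  · rw [norm_mul, norm_eq_abs (cos _)]
    exact mul_le_of_le_one_right (norm_nonneg _) (abs_cos_le_one _)
  · have h := (((hasDerivAt_id x).mul_const y).sin).const_mul (exp (-b * y ^ 2))
    refine h.congr_deriv ?_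
    simp only [id]
    ring

/-- Integration by parts for the half-line transforms of a Gaussian. -/
lemma two_mul_integral_mul_exp_neg_mul_sq_mul_cos {b : ℝ} (hb : 0 < b) (t : ℝ) :
    2 * b * ∫ y in Ioi (0 : ℝ), y * exp (-b * y ^ 2) * cos (t * y) =
      1 - t * ∫ y in Ioi (0 : ℝ), exp (-b * y ^ 2) * sin (t * y) := by
  have hs := (integrableOn_exp_neg_mul_sq_mul_sin hb t).const_mul t
  have hc := (integrableOn_mul_exp_neg_mul_sq_mul_cos hb t).const_mul (2 * b)
  have hlim : Tendsto (fun y : ℝ => exp (-b * y ^ 2)) atTop (𝓝 0) := by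
    refine tendsto_exp_atBot.comp ?_
    exact (tendsto_pow_atTop two_ne_zero).const_mul_atTop_of_neg (neg_lt_zero.mpr hb)
  have hlim' : Tendsto (fun y : ℝ => -(exp (-b * y ^ 2) * cos (t * y))) atTop (𝓝 0) := by
    refine squeeze_zero_norm (fun y => ?_) hlim
    rw [norm_neg, norm_mul, norm_eq_abs, norm_eq_abs, abs_exp]
    exact mul_le_of_le_one_right (exp_pos _).le (abs_cos_le_one _)
  have h := integral_Ioi_of_hasDerivAt_of_tendsto' (a := (0 : ℝ))
    (f := fun y : ℝ => -(exp (-b * y ^ 2) * cos (t * y)))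
    (f' := fun y : ℝ => 2 * b * (y * exp (-b * y ^ 2) * cos (t * y)) +
      t * (exp (-b * y ^ 2) * sin (t * y))) (fun y _ => ?_) (hc.add hs) hlim'
  · rw [integral_add hc hs, integral_const_mul, integral_const_mul] at h
    simp at h
    simp only [neg_mul]
    linarith
  · have h1 := (((hasDerivAt_id y).pow 2).const_mul (-b)).exp
    have h2 := ((hasDerivAt_id y).const_mul t).cos
    refine (h1.mul h2).neg.congr_deriv ?_
    simp only [id, Pi.pow_apply]
    push_cast
    ring

/-- A lower bound for the half-line sine transform of a Gaussian (equivalently, for the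
Dawson function). -/
lemma div_le_integral_exp_neg_mul_sq_mul_sin {b : ℝ} (hb : 0 < b) {t : ℝ} (ht : 0 ≤ t) :
    t / (2 * b + t ^ 2) ≤ ∫ y in Ioi (0 : ℝ), exp (-b * y ^ 2) * sin (t * y) := by
  set S : ℝ → ℝ := fun t => ∫ y in Ioi (0 : ℝ), exp (-b * y ^ 2) * sin (t * y) with hS
  have hder (x : ℝ) : HasDerivAt (fun t => exp (t ^ 2 / (4 * b)) * (S t - t / (2 * b + t ^ 2)))
      (exp (x ^ 2 / (4 * b)) * (2 * x ^ 2 / (2 * b + x ^ 2) ^ 2)) x := by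
    have hpos : 2 * b + x ^ 2 ≠ 0 := by positivity
    have hS' : HasDerivAt S ((1 - x * S x) / (2 * b)) x := by
      convert hasDerivAt_integral_exp_neg_mul_sq_mul_sin hb x using 1
      rw [div_eq_iff (by positivity), hS]
      linarith [two_mul_integral_mul_exp_neg_mul_sq_mul_cos hb x]
    have h1 := ((hasDerivAt_pow 2 x).div_const (4 * b)).exp
    have h2 := (hasDerivAt_id x).div ((hasDerivAt_pow 2 x).const_add (2 * b)) hpos
    refine (h1.mul (hS'.sub h2)).congr_deriv ?_
    simp only [id, Pi.sub_apply, Pi.div_apply]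
    field_simp
    push_cast
    ring
  have hmono := monotone_of_hasDerivAt_nonneg hder (fun x => by positivity)
  have h := hmono ht
  have h0 : S 0 = 0 := by simp [hS]
  simp only [h0] at h
  norm_num at h
  linarith [nonneg_of_mul_nonneg_right h (exp_pos _)]

theorem integral_gaussian_sin_sub_cos_nonneg (a : ℝ) (ha : 0 < a) :
    0 ≤ ∫ y in Set.Ioi (0 : ℝ),
        Real.exp (-y ^ 2 / (4 * a ^ 2)) * (Real.sin y - y * Real.cos y) := by
  obtain ⟨b, hb, hab⟩ : ∃ b : ℝ, 0 < b ∧ ∀ y : ℝ, -y ^ 2 / (4 * a ^ 2) = -b * y ^ 2 :=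
    ⟨1 / (4 * a ^ 2), by positivity, fun y => by ring⟩
  have hs := integrableOn_exp_neg_mul_sq_mul_sin hb 1
  have hc := integrableOn_mul_exp_neg_mul_sq_mul_cos hb 1
  have heq := two_mul_integral_mul_exp_neg_mul_sq_mul_cos hb 1
  have hle := div_le_integral_exp_neg_mul_sq_mul_sin hb zero_le_one
  have hsub := integral_sub hs hc
  simp only [one_mul, one_pow] at heq hle hsub
  rw [div_le_iff₀ (by positivity)] at hle
  have hcongr : ∀ y : ℝ, exp (-y ^ 2 / (4 * a ^ 2)) * (sin y - y * cos y) =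
      exp (-b * y ^ 2) * sin y - y * exp (-b * y ^ 2) * cos y := fun y => by
    rw [hab]; ring
  simp only [hcongr]
  rw [hsub]
  refine nonneg_of_mul_nonneg_right (a := 2 * b) ?_ (by positivity)
  linarith
end

section
/- For every real a ≥ 0: ∫_0^a e^{w²} dw ≥ a·e^{a²}/(1 + 2a²). -/
open Real MeasureTheory

theorem hasDerivAt_mul_exp_sq_div (x : ℝ) :
    HasDerivAt (fun w : ℝ => w * Real.exp (w ^ 2) / (1 + 2 * w ^ 2))
      (Real.exp (x ^ 2) * (1 + 4 * x ^ 4) / (1 + 2 * x ^ 2) ^ 2) x := by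
  have hsq : HasDerivAt (fun w : ℝ => w ^ 2) (2 * x) x := by
    simpa using hasDerivAt_pow 2 x
  have hden : (1 + 2 * x ^ 2 : ℝ) ≠ 0 := by positivity
  refine (((hasDerivAt_id' x).fun_mul hsq.exp).fun_div
    ((hsq.const_mul 2).const_add 1) hden).congr_deriv ?_
  ring

theorem integral_exp_sq_ge (a : ℝ) (ha : 0 ≤ a) :
    a * Real.exp (a ^ 2) / (1 + 2 * a ^ 2) ≤ ∫ w in (0 : ℝ)..a, Real.exp (w ^ 2) := by
  have hcont : Continuous fun w : ℝ => Real.exp (w ^ 2) := by fun_prop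
  have key := intervalIntegral.sub_le_integral_of_hasDeriv_right_of_le ha
    (HasDerivAt.continuousOn fun x _ => hasDerivAt_mul_exp_sq_div x)
    (fun x _ => (hasDerivAt_mul_exp_sq_div x).hasDerivWithinAt)
    hcont.continuousOn.integrableOn_Icc
    (fun x _ => by
      rw [div_le_iff₀ (by positivity)]
      gcongr
      nlinarith [sq_nonneg x])
  simpa using key
end
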